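/- Let A be a weighted pushdown system with integer weights, let ℓ = |Γ|·|Q|, and fix ε = 1/(ℓ^{(ℓ+1)²} · 2ℓ). Then the weighted pushdown system A^ε (same as A but with each edge weight increased by ε) has a good cycle if and only if for every δ > 0 the weighted pushdown system A^δ (each edge weight increased by δ) has a good cycle. -/

import Mathlib

open scoped BigOperators

namespace PDS

/-- Stack commands over a stack alphabet `Γ`. -/
inductive Com (Γ : Type) where
  | skip : Com Γ
  | pop : Com Γ
  | push (z : Γ) : Com Γ
  deriving DecidableEq

/-- Action of a stack command on a stack string (top of stack at the head). -/
def Com.apply {Γ : Type} : Com Γ → List Γ → List Γ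
  | .skip, α => α
  | .pop, α => α.tail
  | .push z, α => z :: α

/-- A transition (edge) of a pushdown system. -/
structure Edge (Q Γ : Type) where
  q1 : Q
  top : Γ
  q2 : Q
  com : Com Γ
  deriving DecidableEq

/-- A weighted pushdown system. -/
structure WPS (Q Γ : Type) where
  q0 : Q
  bot : Γ
  E : Set (Edge Q Γ)
  w : Edge Q Γ → ℤ
  no_push_bot : ∀ e ∈ E, e.com ≠ Com.push bot
  no_pop_bot : ∀ e ∈ E, e.top = bot → e.com ≠ Com.pop

variable {Q Γ : Type}

/-- A configuration: stack string (top at head) together with a state. -/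
abbrev Config (Q Γ : Type) := List Γ × Q

/-- A genuine configuration has a nonempty stack string. -/
def IsConfig (c : Config Q Γ) : Prop := c.1 ≠ []

/-- The initial configuration `(⊥, q₀)`. -/
def WPS.start (A : WPS Q Γ) : Config Q Γ := ([A.bot], A.q0)

/-- The configuration obtained by taking the edge `e` from `c`. -/
def next (c : Config Q Γ) (e : Edge Q Γ) : Config Q Γ := (e.com.apply c.1, e.q2)

/-- The edge `e` is enabled at configuration `c`. -/
def WPS.Enabled (A : WPS Q Γ) (c : Config Q Γ) (e : Edge Q Γ) : Prop :=
  e ∈ A.E ∧ c.2 = e.q1 ∧ c.1.head? = some e.top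

/-- Validity of a finite path, given by a start configuration and a list of edges. -/
def WPS.Valid (A : WPS Q Γ) : Config Q Γ → List (Edge Q Γ) → Prop
  | _, [] => True
  | c, e :: es => A.Enabled c e ∧ A.Valid (next c e) es

/-- Last configuration of the finite path `(c, es)`. -/
def endc (c : Config Q Γ) (es : List (Edge Q Γ)) : Config Q Γ := es.foldl next c

/-- The list of configurations along the finite path `(c, es)`. -/
def trace (c : Config Q Γ) (es : List (Edge Q Γ)) : List (Config Q Γ) :=
  List.scanl next c es

/-- Total weight of a finite path. -/
def WPS.wt (A : WPS Q Γ) (es : List (Edge Q Γ)) : ℤ := (es.map A.w).sum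

/-- Stack height of a configuration. -/
def height (c : Config Q Γ) : ℕ := c.1.length

/-- Stack height of a finite path: maximal stack height along it. -/
def SH (c : Config Q Γ) (es : List (Edge Q Γ)) : ℕ :=
  ((trace c es).map height).foldr max 0

/-- Additional stack height of a finite path. -/
def ASH (c : Config Q Γ) (es : List (Edge Q Γ)) : ℕ :=
  SH c es - max (height c) (height (endc c es))

/-- The first configuration of the path is a local minima: its stack string is a
prefix (here: suffix of the list, since the top is at the head) of all stack strings
along the path. -/
def FirstMin (c : Config Q Γ) (es : List (Edge Q Γ)) : Prop :=
  ∀ c' ∈ trace c es, c.1 <:+ c'.1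

/-- The edge sequence obtained from `u ++ p₁ ++ v ++ p₂ ++ x` by repeating `p₁` and
`p₂` each `j` times in place. -/
def pumped (u p₁ v p₂ x : List (Edge Q Γ)) (j : ℕ) : List (Edge Q Γ) :=
  u ++ (List.replicate j p₁).flatten ++ v ++ (List.replicate j p₂).flatten ++ x

/-- `(p₁, p₂)` is a pumpable pair of paths for the path `(c, es)`. -/
def WPS.PumpablePair (A : WPS Q Γ) (c : Config Q Γ) (es p₁ p₂ : List (Edge Q Γ)) : Prop :=
  p₁ ≠ [] ∧ p₂ ≠ [] ∧
    ∃ u v x, es = u ++ p₁ ++ v ++ p₂ ++ x ∧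
      ∀ j : ℕ, A.Valid c (pumped u p₁ v p₂ x j)

/-- The path `(c, es)` has a pumpable pair of paths. -/
def WPS.HasPumpablePair (A : WPS Q Γ) (c : Config Q Γ) (es : List (Edge Q Γ)) : Prop :=
  ∃ p₁ p₂, A.PumpablePair c es p₁ p₂

/-- `(c, es)` is a good cycle. -/
def WPS.GoodCycle (A : WPS Q Γ) (c : Config Q Γ) (es : List (Edge Q Γ)) : Prop :=
  A.Valid c es ∧ 0 < A.wt es ∧ FirstMin c es ∧
    (endc c es).2 = c.2 ∧ (endc c es).1.head? = c.1.head?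

/-- `A` has a good cycle reachable from the configuration `c`. -/
def WPS.ReachableGoodCycleFrom (A : WPS Q Γ) (c : Config Q Γ) : Prop :=
  ∃ es₀ es, A.Valid c es₀ ∧ A.GoodCycle (endc c es₀) es

/-- `A` has a good cycle (at some configuration). -/
def WPS.HasGoodCycle (A : WPS Q Γ) : Prop :=
  ∃ c es, IsConfig c ∧ A.GoodCycle c es

/-- The finite path `(c, es)` contains a good cycle. -/
def ContainsGoodCycle (A : WPS Q Γ) (c : Config Q Γ) (es : List (Edge Q Γ)) : Prop :=
  ∃ es₁ es₂, es = es₁ ++ es₂ ∧ A.GoodCycle (endc c es₁) es₂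

/-- Configurations along an infinite path given by an infinite edge sequence. -/
def confs (c : Config Q Γ) (f : ℕ → Edge Q Γ) : ℕ → Config Q Γ
  | 0 => c
  | n + 1 => next (confs c f n) (f n)

/-- Validity of the infinite path `(c, f)`. -/
def WPS.ValidInf (A : WPS Q Γ) (c : Config Q Γ) (f : ℕ → Edge Q Γ) : Prop :=
  ∀ n, A.Enabled (confs c f n) (f n)

/-- Average weight of the prefix of length `n+1` of an infinite path. -/
noncomputable def avgPref (A : WPS Q Γ) (f : ℕ → Edge Q Γ) (n : ℕ) : ℝ :=
  (∑ i ∈ Finset.range (n + 1), (A.w (f i) : ℝ)) / (n + 1)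

/-- Limit-sup of the averages along an infinite path. -/
noncomputable def LimSupAvg (A : WPS Q Γ) (f : ℕ → Edge Q Γ) : ℝ :=
  Filter.limsup (avgPref A f) Filter.atTop

/-- Limit-inf of the averages along an infinite path. -/
noncomputable def LimInfAvg (A : WPS Q Γ) (f : ℕ → Edge Q Γ) : ℝ :=
  Filter.liminf (avgPref A f) Filter.atTop

/-- An infinite edge sequence is ultimately periodic. -/
def UltPeriodic (f : ℕ → Edge Q Γ) : Prop :=
  ∃ N p : ℕ, 0 < p ∧ ∀ n, N ≤ n → f (n + p) = f n

/-- The infinite path `(c, f)` is stack bounded. -/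
def StackBounded (c : Config Q Γ) (f : ℕ → Edge Q Γ) : Prop :=
  ∃ n : ℕ, ∀ k, height (confs c f k) ≤ n

/-- Non-decreasing path: a valid path whose first configuration is a local minima. -/
def WPS.NonDec (A : WPS Q Γ) (c : Config Q Γ) (es : List (Edge Q Γ)) : Prop :=
  A.Valid c es ∧ FirstMin c es

/-- Summary function, valued in `EReal`: `⊥` means there is no non-decreasing path
from `(⊥γ,q₁)` to `(⊥γ,q₂)`, `⊤` means `ω` (weights unbounded from above), and
otherwise the value is the maximal weight of such a path. -/
noncomputable def WPS.summary (A : WPS Q Γ) (q₁ : Q) (γ : Γ) (q₂ : Q) : EReal :=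
  sSup { x : EReal | ∃ es, A.NonDec ([γ, A.bot], q₁) es ∧
    endc ([γ, A.bot], q₁) es = ([γ, A.bot], q₂) ∧ x = ((A.wt es : ℝ) : EReal) }

/-- Stack height bounded summary function: as `summary` but only over non-decreasing
paths of additional stack height at most `d`. -/
noncomputable def WPS.summaryBdd (A : WPS Q Γ) (d : ℕ) (q₁ : Q) (γ : Γ) (q₂ : Q) : EReal :=
  sSup { x : EReal | ∃ es, A.NonDec ([γ, A.bot], q₁) es ∧
    endc ([γ, A.bot], q₁) es = ([γ, A.bot], q₂) ∧ ASH ([γ, A.bot], q₁) es ≤ d ∧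
    x = ((A.wt es : ℝ) : EReal) }

/-- Edges of the summary graph `Gr(A)` together with their weights in `EReal`
(`⊤` plays the role of `ω`): skip edges weighted by the summary function and push
edges weighted by the corresponding transition weight. -/
def WPS.GrEdge (A : WPS Q Γ) (v₁ v₂ : Q × Γ) (x : EReal) : Prop :=
  (v₁.2 = v₂.2 ∧ A.summary v₁.1 v₁.2 v₂.1 ≠ ⊥ ∧ x = A.summary v₁.1 v₁.2 v₂.1) ∨
  (∃ e ∈ A.E, e.q1 = v₁.1 ∧ e.top = v₁.2 ∧ e.q2 = v₂.1 ∧ e.com = Com.push v₂.2 ∧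
    x = ((A.w e : ℝ) : EReal))

/-- The summary graph `Gr(A)` has a positive simple cycle: a simple cycle containing
an `ω`-edge or whose total weight is positive. -/
def WPS.PosSimpleCycle (A : WPS Q Γ) : Prop :=
  ∃ (k : ℕ) (v : Fin (k + 1) → Q × Γ) (x : Fin (k + 1) → EReal),
    Function.Injective v ∧ (∀ i, A.GrEdge (v i) (v (i + 1)) (x i)) ∧
    ((∃ i, x i = ⊤) ∨ (0 : EReal) < ∑ i, x i)

/-- Weight of a finite path under the shifted weight function `w + r`. -/
def WPS.wtQ (A : WPS Q Γ) (r : ℚ) (es : List (Edge Q Γ)) : ℚ :=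
  (es.map (fun e => (A.w e : ℚ) + r)).sum

/-- The shifted system `A^r` (weight function `w + r`) has a good cycle. -/
def WPS.GoodCycleShift (A : WPS Q Γ) (r : ℚ) : Prop :=
  ∃ c es, IsConfig c ∧ A.Valid c es ∧ 0 < A.wtQ r es ∧ FirstMin c es ∧
    (endc c es).2 = c.2 ∧ (endc c es).1.head? = c.1.head?

end PDS

namespace PDS

/-- A context-free grammar whose terminal words are recorded only through their length and
weight: leaf rules produce nothing, unary rules one letter, binary rules two letters. -/
structure WGrammar (X : Type) where
  leaf : X → Prop
  un : X → X → ℤ → Prop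
  bin : X → X → X → ℤ → Prop

namespace WGrammar

variable {X : Type} (G : WGrammar X)

/-- `X` derives a word of length `n` and weight `w`. -/
inductive Tree : X → ℕ → ℤ → Prop
  | leaf {x : X} : G.leaf x → Tree x 0 0
  | un {x y : X} {w₀ : ℤ} {n : ℕ} {w : ℤ} : G.un x y w₀ → Tree y n w → Tree x (1 + n) (w₀ + w)
  | bin {x y z : X} {w₀ : ℤ} {n₁ n₂ : ℕ} {w₁ w₂ : ℤ} : G.bin x y z w₀ → Tree y n₁ w₁ →
      Tree z n₂ w₂ → Tree x (2 + n₁ + n₂) (w₀ + w₁ + w₂)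

/-- One derivation step from `x` to a child `y`, with the sibling of `y` fully derived. -/
inductive Step : X → X → ℕ → ℤ → Prop
  | un {x y : X} {w₀ : ℤ} : G.un x y w₀ → Step x y 1 w₀
  | left {x y z : X} {w₀ : ℤ} {n : ℕ} {w : ℤ} : G.bin x y z w₀ → G.Tree z n w →
      Step x y (2 + n) (w₀ + w)
  | right {x y z : X} {w₀ : ℤ} {n : ℕ} {w : ℤ} : G.bin x z y w₀ → G.Tree z n w →
      Step x y (2 + n) (w₀ + w)

/-- A derivation from `x` with exactly one underived nonterminal `y`. -/
inductive Ctx : X → X → ℕ → ℤ → Prop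
  | hole {x : X} : Ctx x x 0 0
  | step {x y z : X} {n₁ n₂ : ℕ} {w₁ w₂ : ℤ} : G.Step x y n₁ w₁ → Ctx y z n₂ w₂ →
      Ctx x z (n₁ + n₂) (w₁ + w₂)

variable {G}

theorem Ctx.single {x y : X} {n : ℕ} {w : ℤ} (h : G.Step x y n w) : G.Ctx x y n w := by
  simpa using Ctx.step h Ctx.hole

theorem Step.pos {x y : X} {n : ℕ} {w : ℤ} (h : G.Step x y n w) : 0 < n := by
  cases h <;> omega

theorem Step.fill {x y : X} {n₁ n₂ : ℕ} {w₁ w₂ : ℤ} (h : G.Step x y n₁ w₁)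
    (t : G.Tree y n₂ w₂) : G.Tree x (n₁ + n₂) (w₁ + w₂) := by
  cases h with
  | un h => exact .un h t
  | left h s =>
    convert Tree.bin h t s using 1 <;> ring
  | right h s => exact .bin h s t

theorem Ctx.fill {x y : X} {n₁ n₂ : ℕ} {w₁ w₂ : ℤ} (h : G.Ctx x y n₁ w₁)
    (t : G.Tree y n₂ w₂) : G.Tree x (n₁ + n₂) (w₁ + w₂) := by
  induction h with
  | hole => simpa using t
  | step s _ ih => convert s.fill (ih t) using 1 <;> ring

theorem Ctx.comp {x y z : X} {n₁ n₂ : ℕ} {w₁ w₂ : ℤ} (h : G.Ctx x y n₁ w₁)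
    (t : G.Ctx y z n₂ w₂) : G.Ctx x z (n₁ + n₂) (w₁ + w₂) := by
  induction h with
  | hole => simpa using t
  | step s _ ih => convert Ctx.step s (ih t) using 1 <;> ring

theorem Ctx.iterate {x : X} {n : ℕ} {w : ℤ} (h : G.Ctx x x n w) (j : ℕ) :
    G.Ctx x x (j * n) (j * w) := by
  induction j with
  | zero => simpa using Ctx.hole
  | succ j ih =>
    convert ih.comp h using 1
    · ring
    · push_cast; ring

variable (G)

/-- `P n w` contains a nonempty loop `y ⇒ y` that may be replaced by any other such loop;
`r` is a lower bound on the length of the remainder. -/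
def Pumpable (P : ℕ → ℤ → Prop) (r n : ℕ) (w : ℤ) : Prop :=
  ∃ y m v a b, 0 < m ∧ r ≤ a ∧ G.Ctx y y m v ∧ n = m + a ∧ w = v + b ∧
    ∀ n' w', G.Ctx y y n' w' → P (n' + a) (w' + b)

variable {G}

theorem Pumpable.lift {P P' : ℕ → ℤ → Prop} {r n k : ℕ} {w u : ℤ} (h : G.Pumpable P r n w)
    (hP : ∀ n' w', P n' w' → P' (k + n') (u + w')) :
    G.Pumpable P' (k + r) (k + n) (u + w) := by
  obtain ⟨y, m, v, a, b, hm, hr, hc, rfl, rfl, H⟩ := h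
  refine ⟨y, m, v, k + a, u + b, hm, by omega, hc, by omega, by omega, fun n' w' h' => ?_⟩
  convert hP _ _ (H n' w' h') using 1 <;> ring

theorem Pumpable.mono {P : ℕ → ℤ → Prop} {r r' n : ℕ} {w : ℤ} (h : G.Pumpable P r n w)
    (hr : r' ≤ r) : G.Pumpable P r' n w := by
  obtain ⟨y, m, v, a, b, hm, hr', H⟩ := h
  exact ⟨y, m, v, a, b, hm, by omega, H⟩

open Classical in
/-- A step prepended to a tree that either is pumpable or revisits a nonterminal of
`insert x F` is pumpable or revisits a nonterminal of `F`. -/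
theorem Step.revisit_tree {x y : X} {F : Finset X} {k n : ℕ} {u w : ℤ} (s : G.Step x y k u)
    (h : G.Pumpable (G.Tree y) 0 n w ∨ ∃ x' ∈ insert x F, ∃ m v a b, G.Ctx y x' m v ∧
      G.Tree x' a b ∧ n = m + a ∧ w = v + b) :
    G.Pumpable (G.Tree x) 0 (k + n) (u + w) ∨ ∃ x' ∈ F, ∃ m v a b, G.Ctx x x' m v ∧
      G.Tree x' a b ∧ k + n = m + a ∧ u + w = v + b := by
  rcases h with h | ⟨x', hx', m, v, a, b, hc, ht, rfl, rfl⟩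
  · exact .inl ((h.lift fun _ _ t => s.fill t).mono (Nat.zero_le _))
  · rcases Finset.mem_insert.1 hx' with rfl | hF
    · exact .inl ⟨x', k + m, u + v, a, b, by have := s.pos; omega, Nat.zero_le _,
        Ctx.step s hc, by omega, by omega, fun n' w' h' => h'.fill ht⟩
    · exact .inr ⟨x', hF, k + m, u + v, a, b, Ctx.step s hc, ht, by omega, by omega⟩

open Classical in
theorem Tree.small_or_pumpable_or_revisit [Fintype X] {x : X} {n : ℕ} {w : ℤ}
    (t : G.Tree x n w) : ∀ F : Finset X,
      n + 2 ≤ 2 ^ (Fintype.card X - F.card) ∨ G.Pumpable (G.Tree x) 0 n w ∨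
      ∃ x' ∈ F, ∃ m v a b, G.Ctx x x' m v ∧ G.Tree x' a b ∧ n = m + a ∧ w = v + b := by
  have key : ∀ {x : X} {F : Finset X}, x ∉ F →
      2 ^ (Fintype.card X - F.card) = 2 * 2 ^ (Fintype.card X - (insert x F).card) := by
    intro x F hx
    have h₁ := Finset.card_le_univ (insert x F)
    rw [Finset.card_insert_of_notMem hx] at h₁ ⊢
    rw [← pow_succ']
    congr 1
    omega
  have self : ∀ {x : X} {F : Finset X} {n : ℕ} {w : ℤ}, x ∈ F → G.Tree x n w →
      ∃ x' ∈ F, ∃ m v a b, G.Ctx x x' m v ∧ G.Tree x' a b ∧ n = m + a ∧ w = v + b :=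
    fun {x F n w} hx t => ⟨x, hx, 0, 0, n, w, .hole, t, by omega, by omega⟩
  induction t with
  | @leaf x h =>
    intro F
    by_cases hx : x ∈ F
    · exact .inr (.inr (self hx (.leaf h)))
    · left
      rw [key hx]
      have := Nat.one_le_two_pow (n := Fintype.card X - (insert x F).card)
      omega
  | @un x y w₀ n w h t ih =>
    intro F
    by_cases hx : x ∈ F
    · exact .inr (.inr (self hx (.un h t)))
    · rcases ih (insert x F) with h₁ | h₁
      · left
        rw [key hx]
        omega
      · exact .inr ((Step.un h).revisit_tree h₁)
  | @bin x y z w₀ n₁ n₂ w₁ w₂ h t₁ t₂ ih₁ ih₂ =>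
    intro F
    by_cases hx : x ∈ F
    · exact .inr (.inr (self hx (.bin h t₁ t₂)))
    · rcases ih₁ (insert x F) with h₁ | h₁
      · rcases ih₂ (insert x F) with h₂ | h₂
        · left
          rw [key hx]
          omega
        · exact .inr ((Step.right h t₁).revisit_tree h₂)
      · have := (Step.left h t₂).revisit_tree h₁
        rw [show 2 + n₁ + n₂ = 2 + n₂ + n₁ by ring, show w₀ + w₁ + w₂ = w₀ + w₂ + w₁ by ring]
        exact .inr this

theorem Tree.small_or_pumpable [Fintype X] {x : X} {n : ℕ} {w : ℤ} (t : G.Tree x n w) :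
    n + 2 ≤ 2 ^ Fintype.card X ∨ G.Pumpable (G.Tree x) 0 n w := by
  simpa using t.small_or_pumpable_or_revisit ∅

theorem Step.small_or_pumpable [Fintype X] {x y : X} {n : ℕ} {w : ℤ} (s : G.Step x y n w) :
    n ≤ 2 ^ Fintype.card X ∨ G.Pumpable (G.Step x y) 1 n w := by
  cases s with
  | un h => exact .inl Nat.one_le_two_pow
  | left h t =>
    rcases t.small_or_pumpable with ht | ht
    · left; omega
    · exact .inr ((ht.lift fun _ _ t' => Step.left h t').mono (by omega))
  | right h t =>
    rcases t.small_or_pumpable with ht | ht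
    · left; omega
    · exact .inr ((ht.lift fun _ _ t' => Step.right h t').mono (by omega))

open Classical in
theorem Ctx.small_or_pumpable_or_revisit [Fintype X] {x y : X} {n : ℕ} {w : ℤ}
    (c : G.Ctx x y n w) : ∀ F : Finset X,
      n ≤ (Fintype.card X - F.card) * 2 ^ Fintype.card X ∨ G.Pumpable (G.Ctx x y) 1 n w ∨
      ∃ x' ∈ F, ∃ m v a b, 0 < a ∧ G.Ctx x x' m v ∧ G.Ctx x' y a b ∧ n = m + a ∧
        w = v + b := by
  induction c with
  | hole => exact fun F => .inl (Nat.zero_le _)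
  | @step x y z n₁ n₂ w₁ w₂ s c ih =>
    intro F
    have hpos := s.pos
    by_cases hx : x ∈ F
    · exact .inr (.inr ⟨x, hx, 0, 0, _, _, by omega, .hole, .step s c, by omega, by omega⟩)
    rcases s.small_or_pumpable with hs | hs
    · rcases ih (insert x F) with h | h | ⟨x', hx', m, v, a, b, ha, hc, hc', rfl, rfl⟩
      · left
        have h₁ := Finset.card_le_univ (insert x F)
        rw [Finset.card_insert_of_notMem hx] at h₁ h
        obtain ⟨k, hk⟩ : ∃ k, Fintype.card X - F.card = k + 1 :=
          ⟨Fintype.card X - (F.card + 1), by omega⟩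
        rw [show Fintype.card X - (F.card + 1) = k by omega] at h
        rw [hk, add_mul]
        omega
      · exact .inr (.inl ((h.lift fun _ _ t => Ctx.step s t).mono (by omega)))
      · rcases Finset.mem_insert.1 hx' with rfl | hF
        · exact .inr (.inl ⟨x', n₁ + m, w₁ + v, a, b, by omega, ha, .step s hc, by omega,
            by omega, fun n' w' h' => h'.comp hc'⟩)
        · exact .inr (.inr ⟨x', hF, n₁ + m, w₁ + v, a, b, ha, .step s hc, hc', by omega,
            by omega⟩)
    · right; left
      rw [add_comm n₁, add_comm w₁]
      refine (hs.lift (k := n₂) (u := w₂) fun n' w' s' => ?_).mono (by omega)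
      rw [add_comm n₂, add_comm w₂]
      exact Ctx.step s' c

theorem Ctx.small_or_pumpable [Fintype X] {x y : X} {n : ℕ} {w : ℤ} (c : G.Ctx x y n w) :
    n ≤ Fintype.card X * 2 ^ Fintype.card X ∨ G.Pumpable (G.Ctx x y) 1 n w := by
  simpa using c.small_or_pumpable_or_revisit ∅

/-- If all loops at `x` have average weight at most `-δ < 0`, then they have average weight at
most `-1 / L`, for a bound `L` depending only on the number of nonterminals. -/
theorem Ctx.length_le [Fintype X] {δ : ℚ} (hδ : 0 < δ) (n : ℕ) :
    ∀ {x : X} {w : ℤ}, (∀ n' w', G.Ctx x x n' w' → (w' : ℚ) + δ * n' ≤ 0) → G.Ctx x x n w →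
      (n : ℤ) ≤ (Fintype.card X * 2 ^ Fintype.card X : ℕ) * (-w) := by
  induction n using Nat.strong_induction_on with
  | _ n ih =>
    intro x w hx c
    rcases c.small_or_pumpable with hn | ⟨y, m, v, a, b, hm, ha, hc, rfl, rfl, H⟩
    · have h := hx n w c
      rcases Nat.eq_zero_or_pos n with rfl | hpos
      · have hw : w ≤ 0 := by
          have : (w : ℚ) ≤ 0 := by simpa using h
          exact_mod_cast this
        have := mul_nonneg (Int.natCast_nonneg (Fintype.card X * 2 ^ Fintype.card X))
          (neg_nonneg.2 hw)
        simpa using this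
      · have hw : w < 0 := by
          have h₁ : 0 < δ * n := by positivity
          have : (w : ℚ) < 0 := by linarith
          exact_mod_cast this
        have h₂ : (n : ℤ) ≤ (Fintype.card X * 2 ^ Fintype.card X : ℕ) := by exact_mod_cast hn
        nlinarith
    · have hy : ∀ n' w', G.Ctx y y n' w' → (w' : ℚ) + δ * n' ≤ 0 := by
        intro n' w' c'
        by_contra! hneg
        obtain ⟨j, hj⟩ := exists_nat_gt (-((b : ℚ) + δ * a) / (w' + δ * n'))
        have h := hx _ _ (H _ _ (c'.iterate j))
        rw [div_lt_iff₀ hneg] at hj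
        push_cast at h
        linarith
      have h₁ := ih m (by omega) hy hc
      have h₂ := ih a (by omega) (w := b) hx (by simpa using H 0 0 .hole)
      push_cast at h₁ h₂ ⊢
      linarith

end WGrammar

section Grammar

variable {Q Γ : Type} (A : WPS Q Γ)

/-- A path from `c` to `c'` along which the stack never drops below `β`. -/
def WPS.Run (β : List Γ) (c : Config Q Γ) (es : List (Edge Q Γ)) (c' : Config Q Γ) : Prop :=
  A.Valid c es ∧ endc c es = c' ∧ ∀ x ∈ trace c es, β <:+ x.1

variable {A}

theorem WPS.Run.nil {β : List Γ} {c : Config Q Γ} (h : β <:+ c.1) : A.Run β c [] c := by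
  refine ⟨trivial, rfl, fun x hx => ?_⟩
  simp only [trace, List.scanl_nil, List.mem_singleton] at hx
  exact hx ▸ h

theorem WPS.Run.cons {β : List Γ} {c c' : Config Q Γ} {e : Edge Q Γ} {es : List (Edge Q Γ)}
    (h : β <:+ c.1) (he : A.Enabled c e) (r : A.Run β (next c e) es c') :
    A.Run β c (e :: es) c' := by
  refine ⟨⟨he, r.1⟩, r.2.1, fun x hx => ?_⟩
  simp only [trace, List.scanl_cons, List.mem_cons] at hx
  rcases hx with rfl | hx
  · exact h
  · exact r.2.2 x hx

theorem WPS.Run.append {β : List Γ} {c c' c'' : Config Q Γ} {es es' : List (Edge Q Γ)}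
    (r : A.Run β c es c') (r' : A.Run β c' es' c'') : A.Run β c (es ++ es') c'' := by
  induction es generalizing c with
  | nil => obtain ⟨-, rfl, -⟩ := r; exact r'
  | cons e es ih =>
    obtain ⟨⟨he, hv⟩, hc, ht⟩ := r
    simp only [trace, List.scanl_cons, List.mem_cons, forall_eq_or_imp] at ht
    exact .cons ht.1 he (ih ⟨hv, hc, ht.2⟩)

theorem WPS.Run.mono {β β' : List Γ} {c c' : Config Q Γ} {es : List (Edge Q Γ)}
    (r : A.Run β c es c') (h : β' <:+ β) : A.Run β' c es c' :=
  ⟨r.1, r.2.1, fun x hx => h.trans (r.2.2 x hx)⟩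

/-- `inl (p, γ, q)` stands for paths from `(γ, p)` back to `(γ, q)` at the same stack level,
`inr (p, γ)` for nondecreasing paths from `(γ, p)`. -/
abbrev Nonterm (Q Γ : Type) := (Q × Γ × Q) ⊕ (Q × Γ)

variable (A)

inductive WPS.UnRule : Nonterm Q Γ → Nonterm Q Γ → ℤ → Prop
  | skip {e : Edge Q Γ} {q : Q} : e ∈ A.E → e.com = .skip →
      UnRule (.inl (e.q1, e.top, q)) (.inl (e.q2, e.top, q)) (A.w e)
  | rise_skip {e : Edge Q Γ} : e ∈ A.E → e.com = .skip →
      UnRule (.inr (e.q1, e.top)) (.inr (e.q2, e.top)) (A.w e)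
  | rise_push {e : Edge Q Γ} {z : Γ} : e ∈ A.E → e.com = .push z →
      UnRule (.inr (e.q1, e.top)) (.inr (e.q2, z)) (A.w e)

inductive WPS.BinRule : Nonterm Q Γ → Nonterm Q Γ → Nonterm Q Γ → ℤ → Prop
  | level {e e' : Edge Q Γ} {q : Q} : e ∈ A.E → e' ∈ A.E → e.com = .push e'.top →
      e'.com = .pop → BinRule (.inl (e.q1, e.top, q)) (.inl (e.q2, e'.top, e'.q1))
        (.inl (e'.q2, e.top, q)) (A.w e + A.w e')
  | rise {e e' : Edge Q Γ} : e ∈ A.E → e' ∈ A.E → e.com = .push e'.top →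
      e'.com = .pop → BinRule (.inr (e.q1, e.top)) (.inl (e.q2, e'.top, e'.q1))
        (.inr (e'.q2, e.top)) (A.w e + A.w e')

/-- The grammar deriving the nondecreasing paths of `A`. -/
def WPS.grammar : WGrammar (Nonterm Q Γ) where
  leaf x := ∃ p γ, x = .inl (p, γ, p)
  un := A.UnRule
  bin := A.BinRule

/-- Realization of a derived word by a path of the same length and weight. -/
def WPS.TreePath : Nonterm Q Γ → ℕ → ℤ → Prop
  | .inl (p, γ, q), n, w => ∃ es, es.length = n ∧ A.wt es = w ∧
      ∀ α, A.Run (γ :: α) (γ :: α, p) es (γ :: α, q)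
  | .inr _, _, _ => True

/-- Realization of a context between rising nonterminals by a nondecreasing path. -/
def WPS.CtxPath : Nonterm Q Γ → Nonterm Q Γ → ℕ → ℤ → Prop
  | .inr (p, γ), .inr (q, γ'), n, w => ∃ es, es.length = n ∧ A.wt es = w ∧
      ∀ α, ∃ β, A.Run (γ :: α) (γ :: α, p) es (γ' :: β, q)
  | .inl _, .inr _, _, _ => False
  | _, .inl _, _, _ => True

variable {A}

theorem WPS.wt_cons (e : Edge Q Γ) (es : List (Edge Q Γ)) : A.wt (e :: es) = A.w e + A.wt es := by
  simp [WPS.wt]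

theorem WPS.wt_append (es es' : List (Edge Q Γ)) : A.wt (es ++ es') = A.wt es + A.wt es' := by
  simp [WPS.wt]

theorem WPS.Run.skip {β α : List Γ} {e : Edge Q Γ} {es : List (Edge Q Γ)} {c : Config Q Γ}
    (he : e ∈ A.E) (hs : e.com = .skip) (h : β <:+ e.top :: α)
    (r : A.Run β (e.top :: α, e.q2) es c) : A.Run β (e.top :: α, e.q1) (e :: es) c :=
  .cons h ⟨he, rfl, rfl⟩ (by simpa [next, hs, Com.apply] using r)

theorem WPS.Run.push {β α : List Γ} {e : Edge Q Γ} {z : Γ} {es : List (Edge Q Γ)}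
    {c : Config Q Γ} (he : e ∈ A.E) (hs : e.com = .push z) (h : β <:+ e.top :: α)
    (r : A.Run β (z :: e.top :: α, e.q2) es c) : A.Run β (e.top :: α, e.q1) (e :: es) c :=
  .cons h ⟨he, rfl, rfl⟩ (by simpa [next, hs, Com.apply] using r)

theorem WPS.Run.pop {β α : List Γ} {e : Edge Q Γ} {es : List (Edge Q Γ)} {c : Config Q Γ}
    (he : e ∈ A.E) (hs : e.com = .pop) (h : β <:+ e.top :: α)
    (r : A.Run β (α, e.q2) es c) : A.Run β (e.top :: α, e.q1) (e :: es) c :=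
  .cons h ⟨he, rfl, rfl⟩ (by simpa [next, hs, Com.apply] using r)

theorem WPS.Run.push_pop {α : List Γ} {e e' : Edge Q Γ} {es es' : List (Edge Q Γ)}
    {c : Config Q Γ} (he : e ∈ A.E) (he' : e' ∈ A.E) (hs : e.com = .push e'.top)
    (hs' : e'.com = .pop)
    (r : A.Run (e'.top :: e.top :: α) (e'.top :: e.top :: α, e.q2) es
      (e'.top :: e.top :: α, e'.q1))
    (r' : A.Run (e.top :: α) (e.top :: α, e'.q2) es' c) :
    A.Run (e.top :: α) (e.top :: α, e.q1) (e :: es ++ e' :: es') c :=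
  .push he hs List.suffix_rfl ((r.mono (List.suffix_cons _ _)).append
    (.pop he' hs' (List.suffix_cons _ _) r'))

theorem WPS.treePath_of_tree {x : Nonterm Q Γ} {n : ℕ} {w : ℤ} (t : A.grammar.Tree x n w) :
    A.TreePath x n w := by
  induction t with
  | leaf h =>
    obtain ⟨p, γ, rfl⟩ := h
    exact ⟨[], rfl, rfl, fun α => .nil List.suffix_rfl⟩
  | un h _ ih =>
    cases h with
    | @skip e q he hs =>
      obtain ⟨es, rfl, rfl, H⟩ := ih
      exact ⟨e :: es, by simp [add_comm], A.wt_cons _ _, fun α =>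
        .skip he hs List.suffix_rfl (H α)⟩
    | _ => trivial
  | bin h _ _ ih₁ ih₂ =>
    cases h with
    | @level e e' q he he' hs hs' =>
      obtain ⟨es, rfl, rfl, H⟩ := ih₁
      obtain ⟨es', rfl, rfl, H'⟩ := ih₂
      refine ⟨e :: es ++ e' :: es', ?_, ?_, fun α => .push_pop he he' hs hs' (H _) (H' α)⟩
      · simp only [List.length_append, List.length_cons]; ring
      · simp only [wt_append, wt_cons]; ring
    | rise => trivial

theorem WPS.ctxPath_of_ctx {x y : Nonterm Q Γ} {n : ℕ} {w : ℤ} (c : A.grammar.Ctx x y n w) :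
    A.CtxPath x y n w := by
  induction c with
  | @hole x =>
    rcases x with x | ⟨p, γ⟩
    · trivial
    · exact ⟨[], rfl, rfl, fun α => ⟨α, .nil List.suffix_rfl⟩⟩
  | @step x y z n₁ n₂ w₁ w₂ s _ ih =>
    rcases z with z | ⟨q, γ'⟩
    · rcases x with x | x <;> trivial
    cases s with
    | un h =>
      cases h with
      | skip => exact ih.elim
      | @rise_skip e he hs =>
        obtain ⟨es, rfl, rfl, H⟩ := ih
        refine ⟨e :: es, by simp [add_comm], A.wt_cons _ _, fun α => ?_⟩
        obtain ⟨β, r⟩ := H α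
        exact ⟨β, .skip he hs List.suffix_rfl r⟩
      | @rise_push e z he hs =>
        obtain ⟨es, rfl, rfl, H⟩ := ih
        refine ⟨e :: es, by simp [add_comm], A.wt_cons _ _, fun α => ?_⟩
        obtain ⟨β, r⟩ := H (e.top :: α)
        exact ⟨β, .push he hs List.suffix_rfl (r.mono (List.suffix_cons _ _))⟩
    | left h t => cases h <;> exact ih.elim
    | right h t =>
      cases h with
      | level => exact ih.elim
      | @rise e e' he he' hs hs' =>
        obtain ⟨es', rfl, rfl, H'⟩ := ih
        obtain ⟨es, rfl, rfl, H⟩ := treePath_of_tree t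
        refine ⟨e :: es ++ e' :: es', ?_, ?_, fun α => ?_⟩
        · simp only [List.length_append, List.length_cons]; ring
        · simp only [wt_append, wt_cons]; ring
        · obtain ⟨β, r⟩ := H' α
          exact ⟨β, .push_pop he he' hs hs' (H _) r⟩

theorem endc_append (c : Config Q Γ) (es es' : List (Edge Q Γ)) :
    endc c (es ++ es') = endc (endc c es) es' :=
  List.foldl_append

theorem endc_mem_trace (c : Config Q Γ) (es es' : List (Edge Q Γ)) :
    endc c es ∈ trace c (es ++ es') := by
  induction es generalizing c with
  | nil => cases es' <;> simp [trace, endc]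
  | cons e es ih =>
    rw [List.cons_append, trace, List.scanl_cons]
    exact List.mem_cons_of_mem _ (ih (next c e))

/-- A valid path either is derived by a rising nonterminal, or has a first pop below its initial
stack level, preceded by a path derived by a level nonterminal. -/
theorem WPS.ctx_or_tree_of_valid (n : ℕ) : ∀ (es : List (Edge Q Γ)) (p : Q) (z : Γ)
    (β : List Γ), es.length = n → A.Valid (z :: β, p) es →
    (∃ q γ' β', endc (z :: β, p) es = (γ' :: β', q) ∧
      A.grammar.Ctx (.inr (p, z)) (.inr (q, γ')) es.length (A.wt es)) ∨
    ∃ es₁ e es₂, es = es₁ ++ e :: es₂ ∧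
      A.grammar.Tree (.inl (p, z, e.q1)) es₁.length (A.wt es₁) ∧ e ∈ A.E ∧ e.com = .pop ∧
      e.top = z ∧ A.Valid (β, e.q2) es₂ ∧ endc (z :: β, p) (es₁ ++ [e]) = (β, e.q2) := by
  induction n using Nat.strong_induction_on with
  | _ n ih =>
    rintro (_ | ⟨e, t⟩) p z β rfl hv
    · exact .inl ⟨p, z, β, rfl, .hole⟩
    obtain ⟨⟨he, hq, hz⟩, hv⟩ := hv
    obtain rfl : p = e.q1 := hq
    obtain rfl : z = e.top := by simpa using hz
    have hend : ∀ es, endc (e.top :: β, e.q1) (e :: es) = endc (next (e.top :: β, e.q1) e) es :=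
      fun _ => rfl
    rw [hend, wt_cons, List.length_cons, add_comm t.length]
    rcases hcom : e.com with _ | _ | y
    · have hnext : next (e.top :: β, e.q1) e = (e.top :: β, e.q2) := by
        simp [next, hcom, Com.apply]
      rw [hnext] at hv hend ⊢
      rcases ih _ (by simp) t e.q2 e.top β rfl hv with
        ⟨q, γ', β', hc, c⟩ | ⟨es₁, e', es₂, rfl, ht, he', hpop, htop, hv', hc⟩
      · exact .inl ⟨q, γ', β', hc, .step (.un (.rise_skip he hcom)) c⟩
      · refine .inr ⟨e :: es₁, e', es₂, rfl, ?_, he', hpop, htop, hv', ?_⟩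
        · rw [wt_cons, List.length_cons, add_comm es₁.length]
          exact .un (.skip he hcom) ht
        · rw [List.cons_append, hend, hc]
    · have hnext : next (e.top :: β, e.q1) e = (β, e.q2) := by
        simp [next, hcom, Com.apply]
      rw [hnext] at hv
      exact .inr ⟨[], e, t, rfl, .leaf ⟨_, _, rfl⟩, he, hcom, rfl, hv, hnext⟩
    · have hnext : next (e.top :: β, e.q1) e = (y :: e.top :: β, e.q2) := by
        simp [next, hcom, Com.apply]
      rw [hnext] at hv hend ⊢
      rcases ih _ (by simp) t e.q2 y (e.top :: β) rfl hv with
        ⟨q, γ', β', hc, c⟩ | ⟨es₁, e', es₂, rfl, ht, he', hpop, rfl, hv', hc⟩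
      · exact .inl ⟨q, γ', β', hc, .step (.un (.rise_push he hcom)) c⟩
      · have hsplit : ∀ es, endc (e'.top :: e.top :: β, e.q2) (es₁ ++ e' :: es) =
            endc (e.top :: β, e'.q2) es := fun es => by
          rw [List.append_cons, endc_append, hc]
        rcases ih es₂.length (by simp; omega) es₂ e'.q2 e.top β rfl hv' with
          ⟨q, γ', β', hc', c⟩ | ⟨es₃, e'', es₄, rfl, ht', he'', hpop', htop, hv'', hc'⟩
        · refine .inl ⟨q, γ', β', by rw [hsplit, hc'], ?_⟩
          convert WGrammar.Ctx.step (.right (WPS.BinRule.rise he he' hcom hpop) ht) c using 1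
          · simp only [List.length_append, List.length_cons]; ring
          · simp only [wt_append, wt_cons]; ring
        · refine .inr ⟨e :: es₁ ++ e' :: es₃, e'', es₄, by simp, ?_, he'', hpop', htop, hv'',
            ?_⟩
          · convert WGrammar.Tree.bin (WPS.BinRule.level he he' hcom hpop) ht ht' using 1
            · simp only [List.length_append, List.length_cons]; ring
            · simp only [wt_append, wt_cons]; ring
          · rw [List.cons_append, List.cons_append, hend, List.append_assoc, List.cons_append,
              hsplit, hc']

theorem WPS.wtQ_eq (r : ℚ) (es : List (Edge Q Γ)) :
    A.wtQ r es = A.wt es + r * es.length := by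
  induction es with
  | nil => simp [WPS.wtQ, WPS.wt]
  | cons e es ih =>
    rw [wt_cons, List.length_cons]
    simp only [WPS.wtQ, List.map_cons, List.sum_cons] at ih ⊢
    rw [ih]
    push_cast
    ring

theorem WPS.goodCycleShift_iff (r : ℚ) : A.GoodCycleShift r ↔
    ∃ p γ n w, A.grammar.Ctx (.inr (p, γ)) (.inr (p, γ)) n w ∧ 0 < (w : ℚ) + r * n := by
  constructor
  · rintro ⟨⟨_ | ⟨γ, α⟩, p⟩, es, hc, hv, hw, hmin, hq, htop⟩
    · exact (hc rfl).elim
    rw [wtQ_eq] at hw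
    rcases ctx_or_tree_of_valid _ es p γ α rfl hv with
      ⟨q, γ', β', hend, c⟩ | ⟨es₁, e, es₂, rfl, -, -, -, -, -, hend⟩
    · rw [hend] at hq htop
      obtain rfl : q = p := hq
      obtain rfl : γ' = γ := by simpa using htop
      exact ⟨_, _, _, _, c, hw⟩
    · have h := hmin _ (by
        rw [List.append_cons]
        exact endc_mem_trace _ (es₁ ++ [e]) es₂)
      rw [hend] at h
      have := h.length_le
      simp at this
  · rintro ⟨p, γ, n, w, c, hw⟩
    obtain ⟨es, rfl, rfl, H⟩ := ctxPath_of_ctx c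
    obtain ⟨β, hv, hend, hmin⟩ := H []
    refine ⟨([γ], p), es, List.cons_ne_nil _ _, hv, by rwa [wtQ_eq], hmin, ?_, ?_⟩ <;>
      rw [hend]
    rfl

/-- If `A` shifted by `1 / L` has a good cycle, for `L` large in the number of nonterminals, then
so does `A` under any positive shift. -/
theorem WPS.goodCycleShift_of_card_le [Fintype Q] [Fintype Γ] {L : ℕ}
    (hL : Fintype.card (Nonterm Q Γ) * 2 ^ Fintype.card (Nonterm Q Γ) ≤ L)
    (h : A.GoodCycleShift (1 / L)) {δ : ℚ} (hδ : 0 < δ) : A.GoodCycleShift δ := by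
  by_contra hno
  rw [goodCycleShift_iff] at h hno
  push Not at hno
  obtain ⟨p, γ, n, w, c, hw⟩ := h
  have hn := WGrammar.Ctx.length_le hδ n (hno p γ) c
  have hw₀ : (w : ℚ) ≤ 0 := by
    have h₁ := hno p γ n w c
    have h₂ : 0 ≤ δ * n := by positivity
    linarith
  have hn' : (n : ℚ) ≤ L * (-w) := by
    have h₁ : (n : ℚ) ≤
        (Fintype.card (Nonterm Q Γ) * 2 ^ Fintype.card (Nonterm Q Γ) : ℕ) * (-w) := by
      exact_mod_cast hn
    have h₂ : ((Fintype.card (Nonterm Q Γ) * 2 ^ Fintype.card (Nonterm Q Γ) : ℕ) : ℚ) ≤ L := by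
      exact_mod_cast hL
    exact h₁.trans (mul_le_mul_of_nonneg_right h₂ (by linarith))
  rcases Nat.eq_zero_or_pos L with rfl | hpos
  · simp only [Nat.cast_zero, div_zero, zero_mul, add_zero] at hw
    exact hw.not_ge hw₀
  · have hL' : (0 : ℚ) < L := by exact_mod_cast hpos
    have : 1 / (L : ℚ) * n ≤ -w := by
      rw [one_div, inv_mul_le_iff₀ hL']
      exact hn'
    linarith

/-- With one state and one stack symbol, all paths consist of skip edges, each of which is
itself a cycle. -/
theorem WPS.goodCycleShift_of_subsingleton [Subsingleton Q] [Subsingleton Γ] {r : ℚ} (hr : r < 1)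
    (h : A.GoodCycleShift r) {δ : ℚ} (hδ : 0 < δ) : A.GoodCycleShift δ := by
  have hskip : ∀ e ∈ A.E, e.com = .skip := fun e he => by
    rcases hcom : e.com with _ | _ | z
    · rfl
    · exact (A.no_pop_bot e he (Subsingleton.elim _ _) hcom).elim
    · exact (A.no_push_bot e he (hcom.trans (congrArg _ (Subsingleton.elim _ _)))).elim
  obtain ⟨c, es, -, hv, hw, -⟩ := h
  obtain ⟨e, he, hwe⟩ : ∃ e ∈ A.E, 0 < (A.w e : ℚ) + r := by
    by_contra! hno
    refine hw.not_ge ?_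
    clear hw
    induction es generalizing c with
    | nil => simp [WPS.wtQ]
    | cons e es ih =>
      have h₁ := ih _ hv.2
      have h₂ := hno e hv.1.1
      simp only [WPS.wtQ, List.map_cons, List.sum_cons] at h₁ ⊢
      linarith
  have hwe' : 0 ≤ A.w e := by
    have : (-1 : ℚ) < A.w e := by linarith
    have : -1 < A.w e := by exact_mod_cast this
    omega
  refine (A.goodCycleShift_iff δ).2 ⟨e.q1, e.top, 1, A.w e, ?_, ?_⟩
  · have h : A.grammar.un (.inr (e.q1, e.top)) (.inr (e.q2, e.top)) (A.w e) :=
      .rise_skip he (hskip e he)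
    rw [Subsingleton.elim e.q2 e.q1] at h
    exact .single (.un h)
  · have : (0 : ℚ) ≤ A.w e := by exact_mod_cast hwe'
    push_cast
    linarith

end Grammar

theorem mul_two_pow_le {N l : ℕ} (hl : 2 ≤ l) (hN : N ≤ l ^ 2 + l) :
    N * 2 ^ N ≤ l ^ ((l + 1) ^ 2) * (2 * l) := by
  calc N * 2 ^ N ≤ (l ^ 2 + l) * l ^ (l ^ 2 + l) := by
        gcongr
        omega
    _ ≤ (2 * l ^ 2) * l ^ (l ^ 2 + l) := by
        gcongr
        nlinarith
    _ = l ^ (l ^ 2 + l + 1) * (2 * l) := by ring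
    _ ≤ l ^ ((l + 1) ^ 2) * (2 * l) := by
        gcongr
        · omega
        · nlinarith

end PDS

open PDS in
/-- with `ℓ = |Γ|·|Q|` and `ε = 1/(ℓ^{(ℓ+1)²}·2ℓ)`, the shifted system
`A^ε` has a good cycle iff `A^δ` has a good cycle for every `δ > 0`. -/
theorem epsilon_good_cycle_iff_all_delta
    {Q Γ : Type} [Fintype Q] [Fintype Γ] (A : WPS Q Γ) :
    A.GoodCycleShift
        (1 / (((Fintype.card Γ * Fintype.card Q : ℕ) : ℚ) ^
            ((Fintype.card Γ * Fintype.card Q + 1) ^ 2) *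
          (2 * ((Fintype.card Γ * Fintype.card Q : ℕ) : ℚ)))) ↔
      ∀ δ : ℚ, 0 < δ → A.GoodCycleShift δ := by
  have : Nonempty Q := ⟨A.q0⟩
  have : Nonempty Γ := ⟨A.bot⟩
  have hΓ : 0 < Fintype.card Γ := Fintype.card_pos
  have hQ : 0 < Fintype.card Q := Fintype.card_pos
  set l := Fintype.card Γ * Fintype.card Q with hl
  have hlpos : 0 < l := Nat.mul_pos hΓ hQ
  have hlpos' : (0 : ℚ) < l := by exact_mod_cast hlpos
  refine ⟨fun h δ hδ => ?_, fun h => h _ (by positivity)⟩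
  rcases Nat.lt_or_ge l 2 with hl₂ | hl₂
  · have hl₁ : l = 1 := by omega
    have hΓ₁ := Nat.eq_one_of_mul_eq_one_right (hl.symm.trans hl₁)
    have hQ₁ := Nat.eq_one_of_mul_eq_one_left (hl.symm.trans hl₁)
    have := Fintype.card_le_one_iff_subsingleton.1 hΓ₁.le
    have := Fintype.card_le_one_iff_subsingleton.1 hQ₁.le
    refine A.goodCycleShift_of_subsingleton ?_ h hδ
    rw [hl₁]
    norm_num
  · have hcard : Fintype.card (Nonterm Q Γ) ≤ l ^ 2 + l := by
      simp only [Fintype.card_sum, Fintype.card_prod]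
      nlinarith [Nat.mul_le_mul_right (Fintype.card Γ * Fintype.card Q ^ 2) hΓ]
    refine WPS.goodCycleShift_of_card_le (mul_two_pow_le hl₂ hcard) ?_ hδ
    exact_mod_cast h
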